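/- arXiv:1001.0775 — 7 statements merged into one kernel-verified Lean document; each statement's English description precedes it below -/
import Mathlib

section
/- The bracket [·,·] on A = R[X]/(X^N) defined from the theta values satisfies the Jacobi identity: for all u, v, w ∈ A, [u,[v,w]] + [w,[u,v]] + [v,[w,u]] = 0. -/
open Polynomial

/-- The condition `b' + c' = N` and `1 < b' < c'`, where for `N = 3` the requirement `1 < b'`
is dropped (i.e. the condition `1 < b' < c'` is replaced by `b' < c'`). -/
def bcond (N b c : ℕ) : Prop := b + c = N ∧ b < c ∧ (N = 3 ∨ 1 < b)

instance (N b c : ℕ) : Decidable (bcond N b c) := by unfold bcond; infer_instance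

/-- The theta values on `{0,…,N−1}³` (extended to all of `ℕ³`): `θ(a,b,c) = 1` if `(a,b,c)`
is a cyclic permutation of a triple `(0,b',c')` with `b' + c' = N` and `1 < b' < c'`
(`b' < c'` when `N = 3`); `θ(a,b,c) = −1` if `(a,b,c)` is a cyclic permutation of such a triple
with `1 < c' < b'` (`c' < b'` when `N = 3`); and `θ(a,b,c) = 0` otherwise. -/
def th (R : Type*) [CommRing R] (N a b c : ℕ) : R :=
  if (a = 0 ∧ bcond N b c) ∨ (b = 0 ∧ bcond N c a) ∨ (c = 0 ∧ bcond N a b) then 1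
  else if (a = 0 ∧ bcond N c b) ∨ (b = 0 ∧ bcond N a c) ∨ (c = 0 ∧ bcond N b a) then -1
  else 0

/-- The sign `θ(0, b, N - b)`, which governs all nonzero brackets of monomials. -/
def thSign (R : Type*) [CommRing R] (N b : ℕ) : R := th R N 0 b (N - b)

section thSign

variable (R : Type*) [CommRing R] {N : ℕ}

lemma th_eq_zero {i j k : ℕ} (hi : i < N) (hj : j < N) (hk : k < N)
    (h : ¬((i = 0 ∧ j + k = N) ∨ (j = 0 ∧ k + i = N) ∨ (k = 0 ∧ i + j = N))) :
    th R N i j k = 0 := by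
  unfold th bcond
  rw [if_neg (by omega), if_neg (by omega)]

lemma th_rotate (i j k : ℕ) : th R N i j k = th R N j k i := by
  unfold th
  congr 1
  · simp only [eq_iff_iff]; tauto
  · congr 1
    simp only [eq_iff_iff]; tauto

lemma th_swap {b c : ℕ} (hb : 0 < b) (hc : 0 < c) : th R N 0 c b = -th R N 0 b c := by
  have h : bcond N b c → ¬bcond N c b := fun h h' => h.2.1.asymm h'.2.1
  simp only [th, hb.ne', hc.ne', true_and, false_and, or_false]
  split_ifs <;> first | tauto | simp

lemma thSign_compl {b : ℕ} (hb : 0 < b) (hbN : b < N) :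
    thSign R N (N - b) = -thSign R N b := by
  unfold thSign
  rw [Nat.sub_sub_self hbN.le, th_swap R hb (by omega)]

lemma thSign_one (h3 : N ≠ 3) (hN : 1 < N) : thSign R N 1 = 0 := by
  unfold thSign th bcond
  split_ifs <;> first | omega | simp

lemma thSign_pred (h3 : N ≠ 3) (hN : 1 < N) : thSign R N (N - 1) = 0 := by
  rw [thSign_compl R one_pos hN, thSign_one R h3 hN, neg_zero]

end thSign

section bracket

variable {R : Type*} [CommRing R] {N : ℕ} {M : Type*} [AddCommGroup M] [Module R M]

lemma sum_th_zero_left (x : ℕ → M) {k : ℕ} (hk : 0 < k) (hkN : k < N) :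
    ∑ i ∈ Finset.range N, th R N i 0 k • x (N - 1 - i) = thSign R N k • x (k - 1) := by
  rw [Finset.sum_eq_single (N - k)]
  · rw [th_rotate, thSign, show N - 1 - (N - k) = k - 1 by omega]
  · intro i hi hne
    rw [Finset.mem_range] at hi
    rw [th_eq_zero R hi (by omega) hkN (by omega), zero_smul]
  · intro h
    simp only [Finset.mem_range] at h
    omega

lemma sum_th_zero_right (x : ℕ → M) {j : ℕ} (hj : 0 < j) (hjN : j < N) :
    ∑ i ∈ Finset.range N, th R N i j 0 • x (N - 1 - i) = -(thSign R N j • x (j - 1)) := by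
  rw [Finset.sum_eq_single (N - j)]
  · rw [← th_rotate, th_swap R hj (by omega), thSign, neg_smul,
      show N - 1 - (N - j) = j - 1 by omega]
  · intro i hi hne
    rw [Finset.mem_range] at hi
    rw [th_eq_zero R hi hjN (by omega) (by omega), zero_smul]
  · intro h
    simp only [Finset.mem_range] at h
    omega

lemma sum_th_zero_zero (x : ℕ → M) :
    ∑ i ∈ Finset.range N, th R N i 0 0 • x (N - 1 - i) = 0 := by
  refine Finset.sum_eq_zero fun i hi => ?_
  rw [Finset.mem_range] at hi
  rw [th_eq_zero R hi (by omega) (by omega) (by omega), zero_smul]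

lemma sum_th_of_pos (x : ℕ → M) {j k : ℕ} (hj : 0 < j) (hjN : j < N) (hk : 0 < k) (hkN : k < N) :
    ∑ i ∈ Finset.range N, th R N i j k • x (N - 1 - i) =
      if j + k = N then thSign R N j • x (N - 1) else 0 := by
  rw [Finset.sum_eq_single 0]
  · split_ifs with h
    · rw [thSign, show N - j = k by omega, Nat.sub_zero]
    · rw [th_eq_zero R (by omega) hjN hkN (by omega), zero_smul]
  · intro i hi hne
    rw [Finset.mem_range] at hi
    rw [th_eq_zero R hi hjN hkN (by omega), zero_smul]
  · intro h
    simp only [Finset.mem_range] at h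
    omega

variable {x : ℕ → M} {brak : M →ₗ[R] M →ₗ[R] M}

lemma brak_top_right (hN : 1 < N) (h3 : N ≠ 3)
    (hbrak : ∀ j k, j < N → k < N →
      brak (x j) (x k) = ∑ i ∈ Finset.range N, th R N i j k • x (N - 1 - i))
    {j : ℕ} (hj : j < N) : brak (x j) (x (N - 1)) = 0 := by
  rw [hbrak _ _ hj (by omega)]
  obtain rfl | hj0 := j.eq_zero_or_pos
  · rw [sum_th_zero_left x (by omega) (by omega), thSign_pred R h3 hN, zero_smul]
  · rw [sum_th_of_pos x hj0 hj (by omega) (by omega)]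
    split_ifs with h
    · rw [show j = 1 by omega, thSign_one R h3 hN, zero_smul]
    · rfl

lemma brak_brak_of_pos (hN : 1 < N) (h3 : N ≠ 3)
    (hbrak : ∀ j k, j < N → k < N →
      brak (x j) (x k) = ∑ i ∈ Finset.range N, th R N i j k • x (N - 1 - i))
    {j k l : ℕ} (hj : j < N) (hk : 0 < k) (hkN : k < N) (hl : 0 < l) (hlN : l < N) :
    brak (x j) (brak (x k) (x l)) = 0 := by
  rw [hbrak k l hkN hlN, sum_th_of_pos x hk hkN hl hlN]
  split_ifs
  · rw [map_smul, brak_top_right hN h3 hbrak hj, smul_zero]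
  · rw [map_zero]

lemma jacobi_zero_pos_pos (hN : 1 < N) (h3 : N ≠ 3)
    (hbrak : ∀ j k, j < N → k < N →
      brak (x j) (x k) = ∑ i ∈ Finset.range N, th R N i j k • x (N - 1 - i))
    {k l : ℕ} (hk : 0 < k) (hkN : k < N) (hl : 0 < l) (hlN : l < N) :
    brak (x 0) (brak (x k) (x l)) + brak (x l) (brak (x 0) (x k)) +
      brak (x k) (brak (x l) (x 0)) = 0 := by
  have hmul : ∀ {a b : ℕ}, 0 < a → a < N → 0 < b → b < N →
      brak (x a) (thSign R N b • x (b - 1)) =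
        if a + b = N + 1 then (thSign R N b * thSign R N a) • x (N - 1) else 0 := by
    intro a b ha haN hb hbN
    rw [map_smul]
    obtain rfl | hb1 := eq_or_ne b 1
    · rw [thSign_one R h3 hN]
      simp
    · rw [hbrak a (b - 1) haN (by omega), sum_th_of_pos x ha haN (by omega) (by omega)]
      by_cases h : a + b = N + 1
      · rw [if_pos h, if_pos (by omega), smul_smul]
      · rw [if_neg h, if_neg (by omega), smul_zero]
  rw [brak_brak_of_pos hN h3 hbrak (by omega) hk hkN hl hlN, hbrak 0 k (by omega) hkN, hbrak l 0 hlN (by omega), sum_th_zero_left x hk hkN,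
    sum_th_zero_right x hl hlN, map_neg, hmul hl hlN hk hkN, hmul hk hkN hl hlN]
  by_cases h : l + k = N + 1
  · rw [if_pos h, if_pos (by omega), mul_comm]
    abel
  · rw [if_neg h, if_neg (by omega)]
    simp

lemma jacobi_zero_zero (hN : 1 < N)
    (hbrak : ∀ j k, j < N → k < N →
      brak (x j) (x k) = ∑ i ∈ Finset.range N, th R N i j k • x (N - 1 - i))
    {l : ℕ} (hl : l < N) :
    brak (x 0) (brak (x 0) (x l)) + brak (x l) (brak (x 0) (x 0)) +
      brak (x 0) (brak (x l) (x 0)) = 0 := by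
  rw [hbrak 0 0 (by omega) (by omega), hbrak 0 l (by omega) hl, hbrak l 0 hl (by omega),
    sum_th_zero_zero]
  obtain rfl | hl0 := l.eq_zero_or_pos
  · simp [sum_th_zero_zero]
  · rw [sum_th_zero_left x hl0 hl, sum_th_zero_right x hl0 hl]
    simp

lemma jacobi_three
    (hbrak : ∀ j k, j < 3 → k < 3 →
      brak (x j) (x k) = ∑ i ∈ Finset.range 3, th R 3 i j k • x (3 - 1 - i))
    {j k l : ℕ} (hj : j < 3) (hk : k < 3) (hl : l < 3) :
    brak (x j) (brak (x k) (x l)) + brak (x l) (brak (x j) (x k)) +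
      brak (x k) (brak (x l) (x j)) = 0 := by
  interval_cases j <;> interval_cases k <;> interval_cases l <;>
    simp [hbrak, Finset.sum_range_succ, th, bcond]

lemma jacobi_monomials (hN : 1 < N)
    (hbrak : ∀ j k, j < N → k < N →
      brak (x j) (x k) = ∑ i ∈ Finset.range N, th R N i j k • x (N - 1 - i))
    {j k l : ℕ} (hj : j < N) (hk : k < N) (hl : l < N) :
    brak (x j) (brak (x k) (x l)) + brak (x l) (brak (x j) (x k)) +
      brak (x k) (brak (x l) (x j)) = 0 := by
  obtain rfl | h3 := eq_or_ne N 3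
  · exact jacobi_three hbrak hj hk hl
  obtain rfl | hj0 := j.eq_zero_or_pos <;> obtain rfl | hk0 := k.eq_zero_or_pos <;>
    obtain rfl | hl0 := l.eq_zero_or_pos
  · exact jacobi_zero_zero hN hbrak hl
  · exact jacobi_zero_zero hN hbrak hl
  · rw [← jacobi_zero_zero hN hbrak hk]; abel
  · exact jacobi_zero_pos_pos hN h3 hbrak hk0 hk hl0 hl
  · rw [← jacobi_zero_zero hN hbrak hj]; abel
  · rw [← jacobi_zero_pos_pos hN h3 hbrak hl0 hl hj0 hj]; abel
  · rw [← jacobi_zero_pos_pos hN h3 hbrak hj0 hj hk0 hk]; abel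
  · rw [brak_brak_of_pos hN h3 hbrak hj hk0 hk hl0 hl,
      brak_brak_of_pos hN h3 hbrak hl hj0 hj hk0 hk,
      brak_brak_of_pos hN h3 hbrak hk hl0 hl hj0 hj]
    simp

lemma jacobi_of_span_eq_top {s : Set M} (hs : Submodule.span R s = ⊤)
    (h : ∀ u ∈ s, ∀ v ∈ s, ∀ w ∈ s,
      brak u (brak v w) + brak w (brak u v) + brak v (brak w u) = 0) (u v w : M) :
    brak u (brak v w) + brak w (brak u v) + brak v (brak w u) = 0 := by
  have extend : ∀ v w : M,
      (∀ u ∈ s, brak u (brak v w) + brak w (brak u v) + brak v (brak w u) = 0) →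
      ∀ u, brak u (brak v w) + brak w (brak u v) + brak v (brak w u) = 0 := by
    intro v w hvw u
    let f : M →ₗ[R] M :=
      brak.flip (brak v w) + brak w ∘ₗ brak.flip v + brak v ∘ₗ brak w
    have hf : f = 0 := LinearMap.ext_on hs fun u hu => hvw u hu
    exact LinearMap.congr_fun hf u
  have rotate : ∀ u v w : M,
      brak u (brak v w) + brak w (brak u v) + brak v (brak w u) =
        brak v (brak w u) + brak u (brak v w) + brak w (brak u v) := fun u v w => by abel
  refine extend v w (fun u hu => ?_) u
  rw [rotate]
  refine extend w u (fun v hv => ?_) v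
  rw [rotate]
  exact extend u v (fun w hw => by rw [rotate]; exact h u hu v hv w hw) w

end bracket

lemma AdjoinRoot.span_root_pow_X_pow (R : Type*) [CommRing R] (N : ℕ) :
    Submodule.span R {y | ∃ k < N, y = AdjoinRoot.root (X ^ N : R[X]) ^ k} = ⊤ := by
  nontriviality R
  rw [eq_top_iff, ← (AdjoinRoot.powerBasis' (monic_X_pow N : (X ^ N : R[X]).Monic)).basis.span_eq]
  refine Submodule.span_mono ?_
  rintro _ ⟨i, rfl⟩
  refine ⟨i, ?_, by simp⟩
  have := i.2
  simpa using this

/-- The bracket on `A = R[X]/(X^N)`, defined `R`-bilinearly on the basis `{1, X, …, X^{N−1}}` by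
`[X^j, X^k] = Σ_{i=0}^{N−1} θ(i,j,k) X^{N−1−i}`, satisfies the Jacobi identity. -/
theorem bracket_jacobi_identity (R : Type*) [CommRing R]
    (N : ℕ) (hN : 1 < N) (hodd : Odd N)
    (brak : AdjoinRoot (X ^ N : R[X]) →ₗ[R] AdjoinRoot (X ^ N : R[X]) →ₗ[R]
      AdjoinRoot (X ^ N : R[X]))
    (hbrak : ∀ j k : ℕ, j < N → k < N →
      brak (AdjoinRoot.root (X ^ N : R[X]) ^ j) (AdjoinRoot.root (X ^ N : R[X]) ^ k) =
        ∑ i ∈ Finset.range N, th R N i j k • AdjoinRoot.root (X ^ N : R[X]) ^ (N - 1 - i)) :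
    ∀ u v w, brak u (brak v w) + brak w (brak u v) + brak v (brak w u) = 0 := by
  refine jacobi_of_span_eq_top (AdjoinRoot.span_root_pow_X_pow R N) ?_
  rintro _ ⟨j, hj, rfl⟩ _ ⟨k, hk, rfl⟩ _ ⟨l, hl, rfl⟩
  exact jacobi_monomials (x := fun k => AdjoinRoot.root (X ^ N : R[X]) ^ k) hN hbrak hj hk hl
end

section
/- If 1 ≠ 0 in R, the Lie bracket on A = R[X]/(X^N) defined from the theta values is non-trivial: there exist u, v ∈ A with [u,v] ≠ 0. -/
open Polynomial

theorem root_X_pow_pow_ne_zero {R : Type*} [CommRing R] (hR : (1 : R) ≠ 0) {N n : ℕ}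
    (hn : n < N) : AdjoinRoot.root (X ^ N : R[X]) ^ n ≠ 0 := by
  rw [← AdjoinRoot.mk_X, ← map_pow, Ne, AdjoinRoot.mk_eq_zero, X_pow_dvd_iff]
  intro h
  exact hR (by simpa using h n hn)

theorem th_eq_ite_of_bcond (R : Type*) [CommRing R] {N b c : ℕ} (h : bcond N b c)
    (hb : b ≠ 0) (a : ℕ) : th R N a b c = if a = 0 then 1 else 0 := by
  have hc : c ≠ 0 := by
    have := h.2.1
    omega
  by_cases ha : a = 0 <;> simp [th, h, hb, hc, ha]

theorem exists_bcond {N : ℕ} (hN : 1 < N) (hodd : Odd N) :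
    ∃ b c, b ≠ 0 ∧ b < N ∧ c < N ∧ bcond N b c := by
  obtain ⟨m, rfl⟩ := hodd
  unfold bcond
  by_cases h : m = 1
  · exact ⟨1, 2, by omega⟩
  · exact ⟨2, 2 * m - 1, by omega⟩

/-- If `1 ≠ 0` in `R`, the Lie bracket on `A = R[X]/(X^N)` defined from the theta values is
non-trivial: there exist `u, v ∈ A` with `[u,v] ≠ 0`. -/
theorem bracket_nontrivial (R : Type*) [CommRing R] (hR : (1 : R) ≠ 0)
    (N : ℕ) (hN : 1 < N) (hodd : Odd N)
    (brak : AdjoinRoot (X ^ N : R[X]) →ₗ[R] AdjoinRoot (X ^ N : R[X]) →ₗ[R]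
      AdjoinRoot (X ^ N : R[X]))
    (hbrak : ∀ j k : ℕ, j < N → k < N →
      brak (AdjoinRoot.root (X ^ N : R[X]) ^ j) (AdjoinRoot.root (X ^ N : R[X]) ^ k) =
        ∑ i ∈ Finset.range N, th R N i j k • AdjoinRoot.root (X ^ N : R[X]) ^ (N - 1 - i)) :
    ∃ u v, brak u v ≠ 0 := by
  obtain ⟨b, c, hb, hbN, hcN, h⟩ := exists_bcond hN hodd
  refine ⟨_, _, (hbrak b c hbN hcN).trans_ne ?_⟩
  have h0 : 0 < N := by omega
  simpa [th_eq_ite_of_bcond R h hb, h0] using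
    root_X_pow_pow_ne_zero hR (show N - 1 < N by omega)
end

section
/- The element Δ(1) satisfies the dual-basis (neck-cutting) property with respect to the Frobenius form ε: for every u ∈ A, u = Σ 1_(1) · ε(1_(2) · u), where Δ(1) = Σ 1_(1) ⊗ 1_(2). -/
open Polynomial TensorProduct

noncomputable section

/-- The base ring `R = ℤ[a,b,c]`, the polynomial ring in three variables over `ℤ`. -/
abbrev R3 : Type := MvPolynomial (Fin 3) ℤ

/-- The variable `a ∈ ℤ[a,b,c]`. -/
def va : R3 := MvPolynomial.X 0
/-- The variable `b ∈ ℤ[a,b,c]`. -/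
def vb : R3 := MvPolynomial.X 1
/-- The variable `c ∈ ℤ[a,b,c]`. -/
def vc : R3 := MvPolynomial.X 2

/-- The polynomial `X³ − aX² − bX − c` over `ℤ[a,b,c]`. -/
def f3 : R3[X] := X ^ 3 - C va * X ^ 2 - C vb * X - C vc

/-- The algebra `A = ℤ[a,b,c][X]/(X³ − aX² − bX − c)`, a free `R3`-module
with basis `{1, X, X²}`. -/
abbrev A3 : Type := AdjoinRoot f3

/-- The image `X ∈ A` of the polynomial variable. -/
def x3 : A3 := AdjoinRoot.root f3

/-- The element `Δ(1) = −(1⊗X² + X⊗X + X²⊗1) + a(1⊗X + X⊗1) + b(1⊗1) ∈ A ⊗_R A`. -/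
def D1 : A3 ⊗[R3] A3 :=
  -((1 : A3) ⊗ₜ[R3] (x3 ^ 2) + x3 ⊗ₜ[R3] x3 + (x3 ^ 2) ⊗ₜ[R3] (1 : A3))
    + va • ((1 : A3) ⊗ₜ[R3] x3 + x3 ⊗ₜ[R3] (1 : A3))
    + vb • ((1 : A3) ⊗ₜ[R3] (1 : A3))

/-- The table of theta values on basis elements `(X^i, X^j, X^k)`:
`θ(1,X,X²) = θ(X²,1,X) = θ(X,X²,1) = 1`, `θ(1,X²,X) = θ(X,1,X²) = θ(X²,X,1) = −1`,
and `θ = 0` on all other triples of basis elements. -/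
def tv (i j k : Fin 3) : R3 :=
  if (i, j, k) = ((0 : Fin 3), (1 : Fin 3), (2 : Fin 3)) ∨
      (i, j, k) = ((2 : Fin 3), (0 : Fin 3), (1 : Fin 3)) ∨
      (i, j, k) = ((1 : Fin 3), (2 : Fin 3), (0 : Fin 3)) then 1
  else if (i, j, k) = ((0 : Fin 3), (2 : Fin 3), (1 : Fin 3)) ∨
      (i, j, k) = ((1 : Fin 3), (0 : Fin 3), (2 : Fin 3)) ∨
      (i, j, k) = ((2 : Fin 3), (1 : Fin 3), (0 : Fin 3)) then -1
  else 0

/-- The branch-curve bracket `[u,v] = Σ θ(1₍₁₎, u, v) · 1₍₂₎`, obtained by contracting the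
explicit element `Δ(1) = −(1⊗X² + X⊗X + X²⊗1) + a(1⊗X + X⊗1) + b(1⊗1)` against the
trilinear form `θ` in its first tensor factor. -/
def br (θ : A3 →ₗ[R3] A3 →ₗ[R3] A3 →ₗ[R3] R3) (u v : A3) : A3 :=
  -(θ 1 u v • x3 ^ 2 + θ x3 u v • x3 + θ (x3 ^ 2) u v • (1 : A3))
    + va • (θ 1 u v • x3 + θ x3 u v • (1 : A3))
    + vb • (θ 1 u v • (1 : A3))

/-- The branch-curve comultiplication `Δ̲(v) = Σ [v, 1₍₁₎] ⊗ 1₍₂₎`, obtained from the explicit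
element `Δ(1) = −(1⊗X² + X⊗X + X²⊗1) + a(1⊗X + X⊗1) + b(1⊗1)`. -/
def Dl (θ : A3 →ₗ[R3] A3 →ₗ[R3] A3 →ₗ[R3] R3) (v : A3) : A3 ⊗[R3] A3 :=
  -((br θ v 1) ⊗ₜ[R3] (x3 ^ 2) + (br θ v x3) ⊗ₜ[R3] x3 + (br θ v (x3 ^ 2)) ⊗ₜ[R3] (1 : A3))
    + va • ((br θ v 1) ⊗ₜ[R3] x3 + (br θ v x3) ⊗ₜ[R3] (1 : A3))
    + vb • ((br θ v 1) ⊗ₜ[R3] (1 : A3))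

/-- The defining relation `X³ = aX² + bX + c` in `A`. -/
theorem x3_pow_three : x3 ^ 3 = va • x3 ^ 2 + vb • x3 + vc • (1 : A3) := by
  have h : AdjoinRoot.mk f3 (X ^ 3 - C va * X ^ 2 - C vb * X - C vc) = 0 :=
    AdjoinRoot.mk_self
  simp only [map_sub, map_mul, map_pow, AdjoinRoot.mk_X, AdjoinRoot.mk_C] at h
  simp only [Algebra.smul_def, AdjoinRoot.algebraMap_eq, x3]
  linear_combination h

/-- The elements `1, X, X²` span `A` over the base ring. -/
theorem exists_eq_smul_one_add_smul_x3 (u : A3) :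
    ∃ p q r : R3, u = p • (1 : A3) + q • x3 + r • x3 ^ 2 := by
  induction u using AdjoinRoot.induction_on with
  | ih g =>
    induction g using Polynomial.induction_on with
    | C s =>
      refine ⟨s, 0, 0, ?_⟩
      simp [Algebra.smul_def, AdjoinRoot.algebraMap_eq]
    | add g₁ g₂ h₁ h₂ =>
      obtain ⟨p₁, q₁, r₁, h₁⟩ := h₁
      obtain ⟨p₂, q₂, r₂, h₂⟩ := h₂
      refine ⟨p₁ + p₂, q₁ + q₂, r₁ + r₂, ?_⟩
      rw [map_add, h₁, h₂]
      module
    | monomial n s h =>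
      obtain ⟨p, q, r, h⟩ := h
      refine ⟨r * vc, p + r * vb, q + r * va, ?_⟩
      rw [pow_succ, ← mul_assoc, map_mul, h, AdjoinRoot.mk_X, ← x3]
      have hx := x3_pow_three
      simp only [Algebra.smul_def, map_add, map_mul] at hx ⊢
      linear_combination algebraMap R3 A3 r * hx

/-- The element `Δ(1)` satisfies the dual-basis (neck-cutting) property with respect to the
Frobenius form `ε`: for every `u ∈ A`, `u = Σ 1₍₁₎ · ε(1₍₂₎ · u)`. -/
theorem delta_one_dual_basis_property (ε : A3 →ₗ[R3] R3)
    (hε1 : ε 1 = 0) (hεx : ε x3 = 0) (hεx2 : ε (x3 ^ 2) = -1) :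
    ∀ u : A3,
      u = -(ε (x3 ^ 2 * u) • (1 : A3) + ε (x3 * u) • x3 + ε u • x3 ^ 2)
            + va • (ε (x3 * u) • (1 : A3) + ε u • x3)
            + vb • (ε u • (1 : A3)) := by
  have hx := x3_pow_three
  have hε3 : ε (x3 ^ 3) = -va := by
    rw [hx]
    simp [hε1, hεx, hεx2]
  have hε4 : ε (x3 ^ 4) = -va ^ 2 - vb := by
    have hx4 : x3 ^ 4 = va • x3 ^ 3 + vb • x3 ^ 2 + vc • x3 := by
      simp only [Algebra.smul_def] at hx ⊢
      linear_combination x3 * hx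
    rw [hx4]
    simp only [map_add, map_smul, hε3, hεx, hεx2, smul_eq_mul]
    ring
  intro u
  obtain ⟨p, q, r, rfl⟩ := exists_eq_smul_one_add_smul_x3 u
  have h₀ : ε (p • (1 : A3) + q • x3 + r • x3 ^ 2) = -r := by
    simp [hε1, hεx, hεx2]
  have h₁ : ε (x3 * (p • (1 : A3) + q • x3 + r • x3 ^ 2)) = -q - r * va := by
    simp only [mul_add, mul_smul_comm, mul_one, ← pow_succ', ← sq, map_add, map_smul,
      hεx, hεx2, hε3, smul_eq_mul]
    ring
  have h₂ : ε (x3 ^ 2 * (p • (1 : A3) + q • x3 + r • x3 ^ 2)) =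
      -p - q * va - r * (va ^ 2 + vb) := by
    simp only [mul_add, mul_smul_comm, mul_one, ← pow_succ, ← pow_add, map_add, map_smul,
      hεx2, hε3, hε4, smul_eq_mul, Nat.reduceAdd]
    ring
  rw [h₀, h₁, h₂]
  module
end
end

section
/- The branch-curve bracket on A satisfies the Jacobi identity: for all u, v, w ∈ A, [u,[v,w]] + [w,[u,v]] + [v,[w,u]] = 0. -/
open Polynomial TensorProduct

noncomputable section

/-- The element of `A` with coordinates `p, q, r` in the basis `{1, X, X²}`. -/
def ofCoords (p q r : R3) : A3 := p • (1 : A3) + q • x3 + r • x3 ^ 2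

theorem f3_monic : f3.Monic := by
  unfold f3
  monicity!

theorem f3_natDegree : f3.natDegree = 3 := by
  unfold f3
  compute_degree!

theorem exists_eq_ofCoords (u : A3) : ∃ p q r : R3, u = ofCoords p q r := by
  obtain ⟨g, rfl⟩ := AdjoinRoot.mk_surjective u
  have hdeg : (g %ₘ f3).natDegree < 3 :=
    (natDegree_modByMonic_lt g f3_monic fun h => by simpa [h] using f3_natDegree).trans_eq
      f3_natDegree
  refine ⟨(g %ₘ f3).coeff 0, (g %ₘ f3).coeff 1, (g %ₘ f3).coeff 2, ?_⟩
  have hmk : AdjoinRoot.mk f3 g = AdjoinRoot.mk f3 (g %ₘ f3) := by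
    rw [AdjoinRoot.mk_eq_mk]
    exact ⟨g /ₘ f3, by linear_combination -modByMonic_add_div g f3⟩
  rw [hmk]
  conv_lhs => rw [(g %ₘ f3).as_sum_range' 3 hdeg]
  simp [Finset.sum_range_succ, ofCoords, x3, Algebra.smul_def, ← C_mul_X_pow_eq_monomial,
    AdjoinRoot.algebraMap_eq]

theorem br_ofCoords (θ : A3 →ₗ[R3] A3 →ₗ[R3] A3 →ₗ[R3] R3)
    (hθ : ∀ i j k : Fin 3, θ (x3 ^ (i : ℕ)) (x3 ^ (j : ℕ)) (x3 ^ (k : ℕ)) = tv i j k)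
    (p q r p' q' r' : R3) :
    br θ (ofCoords p q r) (ofCoords p' q' r') =
      ofCoords (-(p * q' - q * p') + va * (r * p' - p * r') + vb * (q * r' - r * q'))
        (-(r * p' - p * r') + va * (q * r' - r * q')) (-(q * r' - r * q')) := by
  have expand (y : A3) : θ y (ofCoords p q r) (ofCoords p' q' r') =
      p * (p' * θ y 1 1 + q' * θ y 1 x3 + r' * θ y 1 (x3 ^ 2)) +
      q * (p' * θ y x3 1 + q' * θ y x3 x3 + r' * θ y x3 (x3 ^ 2)) +
      r * (p' * θ y (x3 ^ 2) 1 + q' * θ y (x3 ^ 2) x3 + r' * θ y (x3 ^ 2) (x3 ^ 2)) := by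
    simp only [ofCoords, map_add, map_smul, LinearMap.add_apply, LinearMap.smul_apply,
      smul_eq_mul]
    ring
  have h0 : θ 1 (ofCoords p q r) (ofCoords p' q' r') = q * r' - r * q' := by
    have h := hθ 0
    simp [Fin.forall_fin_succ, tv] at h
    simp [expand, h]
    ring
  have h1 : θ x3 (ofCoords p q r) (ofCoords p' q' r') = r * p' - p * r' := by
    have h := hθ 1
    simp [Fin.forall_fin_succ, tv] at h
    simp [expand, h]
    ring
  have h2 : θ (x3 ^ 2) (ofCoords p q r) (ofCoords p' q' r') = p * q' - q * p' := by
    have h := hθ 2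
    simp [Fin.forall_fin_succ, tv] at h
    simp [expand, h]
    ring
  simp only [br, h0, h1, h2]
  unfold ofCoords
  module

/-- The branch-curve bracket on `A` satisfies the Jacobi identity:
`[u,[v,w]] + [w,[u,v]] + [v,[w,u]] = 0` for all `u, v, w ∈ A`. -/
theorem bracket_jacobi (θ : A3 →ₗ[R3] A3 →ₗ[R3] A3 →ₗ[R3] R3)
    (hθ : ∀ i j k : Fin 3, θ (x3 ^ (i : ℕ)) (x3 ^ (j : ℕ)) (x3 ^ (k : ℕ)) = tv i j k) :
    ∀ u v w : A3, br θ u (br θ v w) + br θ w (br θ u v) + br θ v (br θ w u) = 0 := by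
  intro u v w
  obtain ⟨u₀, u₁, u₂, rfl⟩ := exists_eq_ofCoords u
  obtain ⟨v₀, v₁, v₂, rfl⟩ := exists_eq_ofCoords v
  obtain ⟨w₀, w₁, w₂, rfl⟩ := exists_eq_ofCoords w
  simp only [br_ofCoords θ hθ]
  unfold ofCoords
  module
end
end

section
/- The branch-curve comultiplication Δ̲ on A takes the values: Δ̲(1) = 1⊗X − X⊗1; Δ̲(X) = a(1⊗X − X⊗1) − (1⊗X² − X²⊗1); and Δ̲(X²) = (a² + b)(1⊗X − X⊗1) − a(1⊗X² − X²⊗1) + (X⊗X² − X²⊗X). -/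
open Polynomial TensorProduct

noncomputable section

theorem br_pow (θ : A3 →ₗ[R3] A3 →ₗ[R3] A3 →ₗ[R3] R3)
    (hθ : ∀ i j k : Fin 3, θ (x3 ^ (i : ℕ)) (x3 ^ (j : ℕ)) (x3 ^ (k : ℕ)) = tv i j k)
    (j k : Fin 3) :
    br θ (x3 ^ (j : ℕ)) (x3 ^ (k : ℕ)) =
      -(tv 0 j k • x3 ^ 2 + tv 1 j k • x3 + tv 2 j k • (1 : A3))
        + va • (tv 0 j k • x3 + tv 1 j k • (1 : A3)) + vb • (tv 0 j k • (1 : A3)) := by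
  have h0 := hθ 0 j k
  have h1 := hθ 1 j k
  have h2 := hθ 2 j k
  simp only [Fin.val_zero, Fin.val_one, Fin.val_two, pow_zero, pow_one] at h0 h1 h2
  rw [br, h0, h1, h2]

/-- The branch-curve comultiplication takes the values `Δ̲(1) = 1⊗X − X⊗1`,
`Δ̲(X) = a(1⊗X − X⊗1) − (1⊗X² − X²⊗1)`, and
`Δ̲(X²) = (a² + b)(1⊗X − X⊗1) − a(1⊗X² − X²⊗1) + (X⊗X² − X²⊗X)`. -/
theorem comultiplication_values (θ : A3 →ₗ[R3] A3 →ₗ[R3] A3 →ₗ[R3] R3)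
    (hθ : ∀ i j k : Fin 3, θ (x3 ^ (i : ℕ)) (x3 ^ (j : ℕ)) (x3 ^ (k : ℕ)) = tv i j k) :
    Dl θ 1 = (1 : A3) ⊗ₜ[R3] x3 - x3 ⊗ₜ[R3] (1 : A3) ∧
    Dl θ x3 = va • ((1 : A3) ⊗ₜ[R3] x3 - x3 ⊗ₜ[R3] (1 : A3))
        - ((1 : A3) ⊗ₜ[R3] (x3 ^ 2) - (x3 ^ 2) ⊗ₜ[R3] (1 : A3)) ∧
    Dl θ (x3 ^ 2) = (va ^ 2 + vb) • ((1 : A3) ⊗ₜ[R3] x3 - x3 ⊗ₜ[R3] (1 : A3))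
        - va • ((1 : A3) ⊗ₜ[R3] (x3 ^ 2) - (x3 ^ 2) ⊗ₜ[R3] (1 : A3))
        + (x3 ⊗ₜ[R3] (x3 ^ 2) - (x3 ^ 2) ⊗ₜ[R3] x3) := by
  have hbr := br_pow θ hθ
  have b00 : br θ 1 1 = 0 := by simpa [tv] using hbr 0 0
  have b01 : br θ 1 x3 = -1 := by simpa [tv] using hbr 0 1
  have b02 : br θ 1 (x3 ^ 2) = x3 - va • 1 := by
    simpa [tv, sub_eq_add_neg] using hbr 0 2
  have b10 : br θ x3 1 = 1 := by simpa [tv] using hbr 1 0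
  have b11 : br θ x3 x3 = 0 := by simpa [tv] using hbr 1 1
  have b12 : br θ x3 (x3 ^ 2) = -x3 ^ 2 + va • x3 + vb • 1 := by simpa [tv] using hbr 1 2
  have b20 : br θ (x3 ^ 2) 1 = -x3 + va • 1 := by simpa [tv] using hbr 2 0
  have b21 : br θ (x3 ^ 2) x3 = x3 ^ 2 - va • x3 - vb • 1 := by
    simpa [tv, sub_eq_add_neg] using hbr 2 1
  have b22 : br θ (x3 ^ 2) (x3 ^ 2) = 0 := by simpa [tv] using hbr 2 2
  refine ⟨?_, ?_, ?_⟩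
  · simp only [Dl, b00, b01, b02, zero_tmul, neg_tmul, sub_tmul, ← smul_tmul']
    module
  · simp only [Dl, b10, b11, b12, zero_tmul, neg_tmul, add_tmul, ← smul_tmul']
    module
  · simp only [Dl, b20, b21, b22, zero_tmul, neg_tmul, add_tmul, sub_tmul, ← smul_tmul']
    module
end
end

section
/- The branch-curve comultiplication Δ̲ can be defined from the left or from the right: for every v ∈ A, Σ [v, 1_(1)] ⊗ 1_(2) = Σ 1_(1) ⊗ [1_(2), v]. -/
open Polynomial TensorProduct

noncomputable section

/-- Linear maps out of `A3` agree as soon as they agree on `1`, `x3` and `x3 ^ 2`. -/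
theorem A3_hom_ext {M : Type*} [AddCommMonoid M] [Module R3 M] {f g : A3 →ₗ[R3] M}
    (h : ∀ i : Fin 3, f (x3 ^ (i : ℕ)) = g (x3 ^ (i : ℕ))) : f = g := by
  refine (AdjoinRoot.powerBasis' f3_monic).basis.ext fun i => ?_
  have hi : (i : ℕ) < 3 := by
    simpa [f3_natDegree] using i.isLt
  simpa [x3] using h ⟨i, hi⟩

theorem tv_cyclic (i j k : Fin 3) : tv i j k = tv k i j := by
  fin_cases i <;> fin_cases j <;> fin_cases k <;> simp [tv]

theorem theta_cyclic {θ : A3 →ₗ[R3] A3 →ₗ[R3] A3 →ₗ[R3] R3}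
    (hθ : ∀ i j k : Fin 3, θ (x3 ^ (i : ℕ)) (x3 ^ (j : ℕ)) (x3 ^ (k : ℕ)) = tv i j k)
    (i k : Fin 3) (v : A3) :
    θ (x3 ^ (i : ℕ)) v (x3 ^ (k : ℕ)) = θ (x3 ^ (k : ℕ)) (x3 ^ (i : ℕ)) v := by
  have h : (θ (x3 ^ (i : ℕ))).flip (x3 ^ (k : ℕ)) = θ (x3 ^ (k : ℕ)) (x3 ^ (i : ℕ)) :=
    A3_hom_ext fun j => by rw [LinearMap.flip_apply, hθ, hθ, tv_cyclic]
  exact LinearMap.congr_fun h v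

/-- The branch-curve comultiplication can be defined from the left or from the right:
for every `v ∈ A`, `Σ [v, 1₍₁₎] ⊗ 1₍₂₎ = Σ 1₍₁₎ ⊗ [1₍₂₎, v]`. -/
theorem comultiplication_left_eq_right (θ : A3 →ₗ[R3] A3 →ₗ[R3] A3 →ₗ[R3] R3)
    (hθ : ∀ i j k : Fin 3, θ (x3 ^ (i : ℕ)) (x3 ^ (j : ℕ)) (x3 ^ (k : ℕ)) = tv i j k) :
    ∀ v : A3,
      Dl θ v =
        -((1 : A3) ⊗ₜ[R3] (br θ (x3 ^ 2) v) + x3 ⊗ₜ[R3] (br θ x3 v)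
            + (x3 ^ 2) ⊗ₜ[R3] (br θ 1 v))
          + va • ((1 : A3) ⊗ₜ[R3] (br θ x3 v) + x3 ⊗ₜ[R3] (br θ 1 v))
          + vb • ((1 : A3) ⊗ₜ[R3] (br θ 1 v)) := by
  intro v
  have h := theta_cyclic hθ
  simp only [Fin.forall_fin_succ, Fin.forall_fin_zero, Fin.val_zero, Fin.val_succ, pow_zero,
    pow_one, zero_add, one_add_one_eq_two, and_true, forall_and] at h
  obtain ⟨⟨h00, h01, h02⟩, ⟨h10, h11, h12⟩, h20, h21, h22⟩ := h
  simp only [Dl, br, h00, h01, h02, h10, h11, h12, h20, h21, h22, add_tmul, tmul_add,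
    neg_tmul, tmul_neg, ← smul_tmul', tmul_smul]
  module
end
end

section
/- Suppose θ: G³ → R is cyclically symmetric and the induced branch-circle comultiplication satisfies Δ̲(x) = x⊗x for every x ∈ G. Then every element of G has order dividing 2, i.e., x² = 1 for all x ∈ G; moreover θ(x,x,x) = 1 for all x ∈ G, and θ(α,β,γ) = 0 whenever α, β, γ are not all equal. -/
open TensorProduct

/-- The coefficient of `b ⊗ c` in an element of `R[G] ⊗ R[G]`. -/
noncomputable def MonoidAlgebra.tensorCoeff (R G : Type*) [CommRing R] (b c : G) :
    MonoidAlgebra R G ⊗[R] MonoidAlgebra R G →ₗ[R] R :=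
  LinearMap.mul' R R ∘ₗ TensorProduct.map
    (Finsupp.lapply b ∘ₗ (MonoidAlgebra.coeffLinearEquiv R).toLinearMap)
    (Finsupp.lapply c ∘ₗ (MonoidAlgebra.coeffLinearEquiv R).toLinearMap)

theorem MonoidAlgebra.tensorCoeff_of_tmul_of {R G : Type*} [CommRing R] [Monoid G] [DecidableEq G]
    (b c y z : G) :
    MonoidAlgebra.tensorCoeff R G b c
      (MonoidAlgebra.of R G y ⊗ₜ[R] MonoidAlgebra.of R G z) =
      (if y = b then 1 else 0) * (if z = c then 1 else 0) := by
  simp [MonoidAlgebra.tensorCoeff, Finsupp.single_apply]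

/-- Suppose `θ : G³ → R` is cyclically symmetric and the induced branch-circle
comultiplication `Δ̲ : R[G] → R[G] ⊗ R[G]`, defined on basis elements by
`Δ̲(x) = Σ_{y,z ∈ G} θ(x, y⁻¹, z⁻¹) · (y ⊗ z)`, satisfies `Δ̲(x) = x ⊗ x` for every `x ∈ G`.
Then every element of `G` has order dividing `2`, i.e. `x² = 1` for all `x ∈ G`; moreover
`θ(x,x,x) = 1` for all `x ∈ G`, and `θ(α,β,γ) = 0` whenever `α, β, γ` are not all equal. -/
theorem group_algebra_comultiplication_forces_order_two
    (R : Type*) [CommRing R] [Nontrivial R]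
    (G : Type*) [CommGroup G] [Fintype G]
    (θ : G → G → G → R)
    (hcyc : ∀ α β γ : G, θ α β γ = θ β γ α)
    (Dl : MonoidAlgebra R G →ₗ[R] MonoidAlgebra R G ⊗[R] MonoidAlgebra R G)
    (hDl : ∀ x : G, Dl (MonoidAlgebra.of R G x) =
      ∑ y : G, ∑ z : G,
        θ x y⁻¹ z⁻¹ • (MonoidAlgebra.of R G y ⊗ₜ[R] MonoidAlgebra.of R G z))
    (hgrp : ∀ x : G, Dl (MonoidAlgebra.of R G x) =
      MonoidAlgebra.of R G x ⊗ₜ[R] MonoidAlgebra.of R G x) :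
    (∀ x : G, x ^ 2 = 1) ∧ (∀ x : G, θ x x x = 1) ∧
      ∀ α β γ : G, ¬(α = β ∧ β = γ) → θ α β γ = 0 := by
  classical
  have hθ (x b c : G) : θ x b⁻¹ c⁻¹ = (if x = b then 1 else 0) * (if x = c then 1 else 0) := by
    have h := congrArg (MonoidAlgebra.tensorCoeff R G b c) ((hDl x).symm.trans (hgrp x))
    simpa only [map_sum, map_smul, MonoidAlgebra.tensorCoeff_of_tmul_of, smul_eq_mul, mul_ite,
      mul_one, mul_zero, Finset.sum_ite_eq', Finset.sum_const_zero, Finset.mem_univ, if_true]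
      using h
  have hinv (x : G) : x⁻¹ = x := by
    have h₁ := hθ x x x
    have h₂ := hθ x⁻¹ x x⁻¹
    rw [inv_inv, ← hcyc, h₁] at h₂
    by_contra hne
    simp [hne] at h₂
  simp only [hinv] at hθ
  refine ⟨fun x => ?_, fun x => by simp [hθ], fun α β γ hne => ?_⟩
  · rw [pow_two, mul_eq_one_iff_eq_inv, hinv]
  · rw [hθ]
    by_cases hαβ : α = β
    · subst hαβ
      simp_all
    · simp [hαβ]
end
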